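/- arXiv:1701.05298 — 3 statements merged into one kernel-verified Lean document; each statement's English description precedes it below -/
import Mathlib

section
/- Let (x, μ, λ) ∈ ℝⁿ × ℝᵐ × E be a KKT triple of problem (P1), where E has rank r. Suppose (SOSC-NSCP): ⟨∇²_x L(x,μ,λ)v, v⟩ + 2⟨w∘w, λ⟩ > 0 for every nonzero (v, w) ∈ ℝⁿ × E such that Dg(x)v − 2 √(g(x))∘w = 0 and Dh(x)v = 0. Then x is a local minimum of (P1) and strict complementarity holds, i.e., rank g(x) + rank λ = r. -/
open scoped RealInnerProductSpace

noncomputable section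

/-- A Euclidean Jordan algebra structure on a finite-dimensional real inner
product space `E`: a commutative bilinear product `jmul` with unit, satisfying
the Jordan identity and compatibility with the inner product, together with the
spectral theorem (every element has a spectral decomposition along a Jordan
frame of size `rank`) and the normalization `⟪c, c⟫ = 1` for primitive
idempotents, which encodes that the inner product is the trace form. -/
structure EJA (E : Type*) [NormedAddCommGroup E] [InnerProductSpace ℝ E]
    [FiniteDimensional ℝ E] where
  jmul : E →ₗ[ℝ] E →ₗ[ℝ] E
  comm : ∀ y z : E, jmul y z = jmul z y
  unit : E
  unit_jmul : ∀ y : E, jmul unit y = y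
  jordan : ∀ y z : E, jmul y (jmul (jmul y y) z) = jmul (jmul y y) (jmul y z)
  assoc_inner : ∀ y z w : E, ⟪jmul y z, w⟫ = ⟪y, jmul z w⟫
  rank : ℕ
  spectral : ∀ y : E, ∃ (c : Fin rank → E) (σ : Fin rank → ℝ),
    (∀ i, jmul (c i) (c i) = c i) ∧
    (∀ i, c i ≠ 0) ∧
    (∀ i, ∀ a b : E, jmul a a = a → jmul b b = b → a ≠ 0 → b ≠ 0 →
      jmul a b = 0 → c i ≠ a + b) ∧
    (∀ i j, i ≠ j → jmul (c i) (c j) = 0) ∧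
    (∑ i, c i) = unit ∧
    y = ∑ i, σ i • c i
  inner_primitive : ∀ c : E, jmul c c = c → c ≠ 0 →
    (∀ a b : E, jmul a a = a → jmul b b = b → a ≠ 0 → b ≠ 0 →
      jmul a b = 0 → c ≠ a + b) →
    ⟪c, c⟫ = 1

namespace EJA

variable {E : Type*} [NormedAddCommGroup E] [InnerProductSpace ℝ E]
  [FiniteDimensional ℝ E]

/-- `c` is an idempotent. -/
def IsIdempotent (J : EJA E) (c : E) : Prop := J.jmul c c = c

/-- `c` is a primitive idempotent. -/
def IsPrimitive (J : EJA E) (c : E) : Prop :=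
  J.IsIdempotent c ∧ c ≠ 0 ∧
    ∀ a b : E, J.IsIdempotent a → J.IsIdempotent b → a ≠ 0 → b ≠ 0 →
      J.jmul a b = 0 → c ≠ a + b

/-- A Jordan frame: primitive idempotents, pairwise orthogonal (w.r.t. the
Jordan product), summing to the unit. -/
def IsJordanFrame (J : EJA E) (c : Fin J.rank → E) : Prop :=
  (∀ i, J.IsPrimitive (c i)) ∧ (∀ i j, i ≠ j → J.jmul (c i) (c j) = 0) ∧
    (∑ i, c i) = J.unit

/-- The symmetric cone: the cone of squares of the algebra. -/
def K (J : EJA E) : Set E := {z : E | ∃ y : E, z = J.jmul y y}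

/-- `y` has rank `k`: some spectral decomposition of `y` has exactly `k`
nonzero eigenvalues.  (By uniqueness of eigenvalues this is well-defined.) -/
def HasRank (J : EJA E) (y : E) (k : ℕ) : Prop :=
  ∃ (c : Fin J.rank → E) (σ : Fin J.rank → ℝ),
    J.IsJordanFrame c ∧ y = ∑ i, σ i • c i ∧
      (Finset.univ.filter (fun i => σ i ≠ 0)).card = k

/-- `t` is an eigenvalue of `y`. -/
def IsEigenvalue (J : EJA E) (y : E) (t : ℝ) : Prop :=
  ∃ (c : Fin J.rank → E) (σ : Fin J.rank → ℝ) (i : Fin J.rank),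
    J.IsJordanFrame c ∧ y = ∑ j, σ j • c j ∧ σ i = t

/-- `p` is a nearest point of the symmetric cone `K` to `v`. -/
def IsProj (J : EJA E) (v p : E) : Prop :=
  p ∈ J.K ∧ ∀ z ∈ J.K, ‖v - p‖ ≤ ‖v - z‖

/-- A (linear subspace that is a) subalgebra. -/
def IsSubalgebra (J : EJA E) (V : Submodule ℝ E) : Prop :=
  ∀ a ∈ V, ∀ b ∈ V, J.jmul a b ∈ V

/-- The algebra is simple: it is not the direct sum of two nonzero
subalgebras. -/
def IsSimple (J : EJA E) : Prop :=
  ¬ ∃ V W : Submodule ℝ E, J.IsSubalgebra V ∧ J.IsSubalgebra W ∧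
      V ≠ ⊥ ∧ W ≠ ⊥ ∧ V ⊓ W = ⊥ ∧ V ⊔ W = ⊤

/-- The tangent cone of the convex set `K` at `z`:
the closure of `⋃_{t>0} t (K - z)`. -/
def tangentCone (J : EJA E) (z : E) : Set E :=
  closure {d : E | ∃ t : ℝ, 0 < t ∧ ∃ k ∈ J.K, d = t • (k - z)}

/-- The lineality space `T_K(z) ∩ (-T_K(z))` of the tangent cone. -/
def linTangent (J : EJA E) (z : E) : Set E :=
  {d : E | d ∈ J.tangentCone z ∧ -d ∈ J.tangentCone z}

/-- The Lagrangian of problem (P1):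
`L(x, μ, λ) = f(x) - ⟪h(x), μ⟫ - ⟪g(x), λ⟫`. -/
def lagr {n m : ℕ} (f : EuclideanSpace ℝ (Fin n) → ℝ)
    (h : EuclideanSpace ℝ (Fin n) → EuclideanSpace ℝ (Fin m))
    (g : EuclideanSpace ℝ (Fin n) → E) (μ : EuclideanSpace ℝ (Fin m)) (lam : E)
    (x : EuclideanSpace ℝ (Fin n)) : ℝ :=
  f x - ⟪h x, μ⟫ - ⟪g x, lam⟫

/-- The Lagrangian of the slack-variable problem (P2), as a function of the
pair `(x, y)`. -/
def lagrSlack (J : EJA E) {n m : ℕ} (f : EuclideanSpace ℝ (Fin n) → ℝ)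
    (h : EuclideanSpace ℝ (Fin n) → EuclideanSpace ℝ (Fin m))
    (g : EuclideanSpace ℝ (Fin n) → E) (μ : EuclideanSpace ℝ (Fin m)) (lam : E)
    (p : EuclideanSpace ℝ (Fin n) × E) : ℝ :=
  f p.1 - ⟪h p.1, μ⟫ - ⟪g p.1 - J.jmul p.2 p.2, lam⟫

/-- `(x, μ, lam)` is a KKT triple of problem (P1). -/
def KKTP1 (J : EJA E) {n m : ℕ} (f : EuclideanSpace ℝ (Fin n) → ℝ)
    (h : EuclideanSpace ℝ (Fin n) → EuclideanSpace ℝ (Fin m))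
    (g : EuclideanSpace ℝ (Fin n) → E)
    (x : EuclideanSpace ℝ (Fin n)) (μ : EuclideanSpace ℝ (Fin m)) (lam : E) : Prop :=
  gradient f x - (fderiv ℝ h x).adjoint μ - (fderiv ℝ g x).adjoint lam = 0 ∧
    lam ∈ J.K ∧ g x ∈ J.K ∧ J.jmul lam (g x) = 0 ∧ h x = 0

/-- `(x, y, μ, lam)` is a KKT quadruple of the slack-variable problem (P2). -/
def KKTP2 (J : EJA E) {n m : ℕ} (f : EuclideanSpace ℝ (Fin n) → ℝ)
    (h : EuclideanSpace ℝ (Fin n) → EuclideanSpace ℝ (Fin m))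
    (g : EuclideanSpace ℝ (Fin n) → E)
    (x : EuclideanSpace ℝ (Fin n)) (y : E) (μ : EuclideanSpace ℝ (Fin m))
    (lam : E) : Prop :=
  gradient f x - (fderiv ℝ h x).adjoint μ - (fderiv ℝ g x).adjoint lam = 0 ∧
    J.jmul lam y = 0 ∧ g x = J.jmul y y ∧ h x = 0

/-- The augmented Lagrangian of the slack-variable problem (P2). -/
def augSlack (J : EJA E) {n m : ℕ} (f : EuclideanSpace ℝ (Fin n) → ℝ)
    (h : EuclideanSpace ℝ (Fin n) → EuclideanSpace ℝ (Fin m))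
    (g : EuclideanSpace ℝ (Fin n) → E) (ρ : ℝ) (μ : EuclideanSpace ℝ (Fin m))
    (lam : E) (x : EuclideanSpace ℝ (Fin n)) (y : E) : ℝ :=
  f x - ⟪h x, μ⟫ + ρ / 2 * ‖h x‖ ^ 2 - ⟪g x - J.jmul y y, lam⟫
    + ρ / 2 * ‖g x - J.jmul y y‖ ^ 2

/-- The augmented Lagrangian of problem (P1), where `P` is the metric
projection onto the symmetric cone `K`. -/
def augSym (J : EJA E) {n m : ℕ} (f : EuclideanSpace ℝ (Fin n) → ℝ)
    (h : EuclideanSpace ℝ (Fin n) → EuclideanSpace ℝ (Fin m))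
    (g : EuclideanSpace ℝ (Fin n) → E) (P : E → E) (ρ : ℝ)
    (μ : EuclideanSpace ℝ (Fin m)) (lam : E)
    (x : EuclideanSpace ℝ (Fin n)) : ℝ :=
  f x - ⟪h x, μ⟫ + ρ / 2 * ‖h x‖ ^ 2
    + 1 / (2 * ρ) * (-‖lam‖ ^ 2 + ‖P (lam - ρ • g x)‖ ^ 2)

end EJA

namespace EJA

variable {E : Type*} [NormedAddCommGroup E] [InnerProductSpace ℝ E]
  [FiniteDimensional ℝ E] (J : EJA E)

/-- The linearized Jordan identity `[L(a), L(b²)] + 2 [L(b), L(a ∘ b)] = 0`. -/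
theorem jordan_linearized (a b z : E) :
    J.jmul a (J.jmul (J.jmul b b) z) - J.jmul (J.jmul b b) (J.jmul a z)
      + (2 : ℝ) • (J.jmul b (J.jmul (J.jmul a b) z) - J.jmul (J.jmul a b) (J.jmul b z)) = 0 := by
  have h₁ := J.jordan (b + a) z
  have h₂ := J.jordan (b - a) z
  have h₃ := J.jordan a z
  simp only [map_add, map_sub, LinearMap.add_apply, LinearMap.sub_apply, J.comm b a] at h₁ h₂
  refine smul_right_injective E (two_ne_zero (α := ℝ)) ?_
  simp only [smul_zero]
  linear_combination (norm := module) h₁ - h₂ - (2 : ℝ) • h₃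

theorem unit_jmul_right (y : E) : J.jmul y J.unit = y := by
  rw [J.comm, J.unit_jmul]

theorem inner_jmul_unit (a b : E) : ⟪J.jmul a b, J.unit⟫ = ⟪a, b⟫ := by
  rw [J.assoc_inner, J.unit_jmul_right]

theorem inner_jmul_left (a b c : E) : ⟪J.jmul a b, c⟫ = ⟪b, J.jmul a c⟫ := by
  rw [J.comm, J.assoc_inner]

/-- The cubic equation satisfied by multiplication by an idempotent. -/
theorem peirce_cubic {c : E} (hc : J.jmul c c = c) (a : E) :
    (2 : ℝ) • J.jmul c (J.jmul c (J.jmul c a)) =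
      (3 : ℝ) • J.jmul c (J.jmul c a) - J.jmul c a := by
  have key := J.jordan_linearized a c c
  simp only [hc, J.comm a c, J.comm (J.jmul c a) c] at key
  linear_combination (norm := module) key

/-- The quadratic form of multiplication by an idempotent as a sum of squares. -/
theorem inner_idempotent_jmul {c : E} (hc : J.jmul c c = c) (a : E) :
    ⟪J.jmul c a, a⟫ = ‖(2 : ℝ) • J.jmul c (J.jmul c a) - J.jmul c a‖ ^ 2
      + 8 * ‖J.jmul c a - J.jmul c (J.jmul c a)‖ ^ 2 := by
  have h₃ := J.peirce_cubic hc a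
  have h₄ := J.peirce_cubic hc (J.jmul c a)
  have e₃ := congrArg (fun z => ⟪z, a⟫) h₃
  have e₄ := congrArg (fun z => ⟪z, a⟫) h₄
  simp only [← real_inner_self_eq_norm_sq, inner_sub_left, inner_sub_right, inner_smul_left,
    inner_smul_right, J.inner_jmul_left c, RCLike.conj_to_real] at e₃ e₄ ⊢
  linarith

theorem inner_idempotent_jmul_nonneg {c : E} (hc : J.jmul c c = c) (a : E) :
    0 ≤ ⟪J.jmul c a, a⟫ := by
  rw [J.inner_idempotent_jmul hc]
  positivity

theorem idempotent_jmul_eq_zero {c : E} (hc : J.jmul c c = c) {a : E}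
    (h : ⟪J.jmul c a, a⟫ = 0) : J.jmul c a = 0 := by
  rw [J.inner_idempotent_jmul hc] at h
  have h₁ : (2 : ℝ) • J.jmul c (J.jmul c a) - J.jmul c a = 0 := by
    rw [← norm_eq_zero, ← sq_eq_zero_iff]
    nlinarith [sq_nonneg ‖(2 : ℝ) • J.jmul c (J.jmul c a) - J.jmul c a‖,
      sq_nonneg ‖J.jmul c a - J.jmul c (J.jmul c a)‖]
  have h₂ : J.jmul c a - J.jmul c (J.jmul c a) = 0 := by
    rw [← norm_eq_zero, ← sq_eq_zero_iff]
    nlinarith [sq_nonneg ‖(2 : ℝ) • J.jmul c (J.jmul c a) - J.jmul c a‖,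
      sq_nonneg ‖J.jmul c a - J.jmul c (J.jmul c a)‖]
  linear_combination (norm := module) h₁ + (2 : ℝ) • h₂

theorem exists_frame (y : E) : ∃ (c : Fin J.rank → E) (σ : Fin J.rank → ℝ),
    J.IsJordanFrame c ∧ y = ∑ i, σ i • c i := by
  obtain ⟨c, σ, hid, hne, hprim, horth, hsum, hy⟩ := J.spectral y
  exact ⟨c, σ, ⟨fun i => ⟨hid i, hne i, hprim i⟩, horth, hsum⟩, hy⟩

variable {J}

theorem IsJordanFrame.jmul_self {c : Fin J.rank → E} (hc : J.IsJordanFrame c) (i : Fin J.rank) :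
    J.jmul (c i) (c i) = c i := (hc.1 i).1

theorem IsJordanFrame.jmul_eq {c : Fin J.rank → E} (hc : J.IsJordanFrame c) (i j : Fin J.rank) :
    J.jmul (c i) (c j) = if i = j then c i else 0 := by
  split_ifs with h
  · subst h; exact hc.jmul_self i
  · exact hc.2.1 i j h

theorem IsJordanFrame.inner_eq {c : Fin J.rank → E} (hc : J.IsJordanFrame c)
    (i j : Fin J.rank) : ⟪c i, c j⟫ = if i = j then (1 : ℝ) else 0 := by
  split_ifs with h
  · subst h; exact J.inner_primitive _ (hc.1 i).1 (hc.1 i).2.1 (hc.1 i).2.2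
  · rw [← J.inner_jmul_unit, hc.2.1 i j h, inner_zero_left]

theorem IsJordanFrame.jmul_sum {c : Fin J.rank → E} (hc : J.IsJordanFrame c)
    (σ τ : Fin J.rank → ℝ) :
    J.jmul (∑ i, σ i • c i) (∑ i, τ i • c i) = ∑ i, (σ i * τ i) • c i := by
  simp [map_sum, LinearMap.sum_apply, hc.jmul_eq, smul_smul, mul_comm]

theorem IsJordanFrame.inner_sum_sum {c : Fin J.rank → E} (hc : J.IsJordanFrame c)
    (σ τ : Fin J.rank → ℝ) :
    ⟪∑ i, σ i • c i, ∑ i, τ i • c i⟫ = ∑ i, σ i * τ i := by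
  simp [sum_inner, inner_sum, hc.inner_eq, inner_smul_left, inner_smul_right, mul_comm]

theorem IsJordanFrame.inner_sum_left {c : Fin J.rank → E} (hc : J.IsJordanFrame c)
    (σ : Fin J.rank → ℝ) (j : Fin J.rank) : ⟪∑ i, σ i • c i, c j⟫ = σ j := by
  simp [sum_inner, hc.inner_eq, inner_smul_left]

/-- An element of the cone is a nonnegative combination of a Jordan frame. -/
theorem exists_frame_sq_of_mem_K {b : E} (hb : b ∈ J.K) :
    ∃ (c : Fin J.rank → E) (σ : Fin J.rank → ℝ),
      J.IsJordanFrame c ∧ b = ∑ i, (σ i * σ i) • c i := by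
  obtain ⟨y, rfl⟩ := hb
  obtain ⟨c, σ, hc, rfl⟩ := J.exists_frame y
  exact ⟨c, σ, hc, hc.jmul_sum σ σ⟩

theorem inner_sq_nonneg {b : E} (hb : b ∈ J.K) (a : E) : 0 ≤ ⟪J.jmul a a, b⟫ := by
  obtain ⟨c, σ, hc, rfl⟩ := exists_frame_sq_of_mem_K hb
  rw [inner_sum]
  refine Finset.sum_nonneg fun i _ => ?_
  rw [inner_smul_right, J.inner_jmul_left, J.comm, real_inner_comm]
  exact mul_nonneg (mul_self_nonneg _) (J.inner_idempotent_jmul_nonneg (hc.jmul_self i) a)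

theorem jmul_eq_zero_of_inner_sq_eq_zero {b : E} (hb : b ∈ J.K) {a : E}
    (h : ⟪J.jmul a a, b⟫ = 0) : J.jmul a b = 0 := by
  obtain ⟨c, σ, hc, rfl⟩ := exists_frame_sq_of_mem_K hb
  have hterm : ∀ i, ⟪J.jmul a a, (σ i * σ i) • c i⟫ = σ i * σ i * ⟪J.jmul (c i) a, a⟫ := by
    intro i
    rw [inner_smul_right, J.inner_jmul_left, J.comm, real_inner_comm]
  rw [inner_sum, Finset.sum_eq_zero_iff_of_nonneg] at h
  · rw [map_sum]
    refine Finset.sum_eq_zero fun i hi => ?_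
    have hi' := h i hi
    rw [hterm] at hi'
    rw [map_smul, J.comm]
    rcases mul_eq_zero.1 hi' with h0 | h0
    · rw [h0, zero_smul]
    · rw [J.idempotent_jmul_eq_zero (hc.jmul_self i) h0, smul_zero]
  · intro i _
    rw [hterm]
    exact mul_nonneg (mul_self_nonneg _) (J.inner_idempotent_jmul_nonneg (hc.jmul_self i) a)

theorem inner_nonneg_of_mem_K {a b : E} (ha : a ∈ J.K) (hb : b ∈ J.K) : 0 ≤ ⟪a, b⟫ := by
  obtain ⟨y, rfl⟩ := ha
  exact inner_sq_nonneg hb y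

theorem idempotent_mem_K {c : E} (hc : J.jmul c c = c) : c ∈ J.K := ⟨c, hc.symm⟩

/-- Orthogonal elements of the symmetric cone have zero Jordan product. -/
theorem jmul_eq_zero_of_inner_eq_zero {a b : E} (ha : a ∈ J.K) (hb : b ∈ J.K)
    (h : ⟪a, b⟫ = 0) : J.jmul a b = 0 := by
  obtain ⟨c, σ, hc, rfl⟩ := exists_frame_sq_of_mem_K ha
  simp only [sum_inner, inner_smul_left, RCLike.conj_to_real] at h
  rw [Finset.sum_eq_zero_iff_of_nonneg fun i _ => mul_nonneg (mul_self_nonneg _)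
    (inner_nonneg_of_mem_K (idempotent_mem_K (hc.jmul_self i)) hb)] at h
  rw [map_sum, LinearMap.sum_apply]
  refine Finset.sum_eq_zero fun i hi => ?_
  rw [map_smul, LinearMap.smul_apply]
  rcases mul_eq_zero.1 (h i hi) with h0 | h0
  · rw [h0, zero_smul]
  · rw [jmul_eq_zero_of_inner_sq_eq_zero hb (by rwa [hc.jmul_self]), smul_zero]

theorem norm_sq_eq_inner_unit (a : E) : ‖a‖ ^ 2 = ⟪J.jmul a a, J.unit⟫ := by
  rw [J.inner_jmul_unit, real_inner_self_eq_norm_sq]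

theorem eq_zero_of_sq_eq_zero {a : E} (h : J.jmul a a = 0) : a = 0 := by
  have := norm_sq_eq_inner_unit (J := J) a
  rw [h, inner_zero_left] at this
  simpa using this

/-- Square roots in the symmetric cone are unique. -/
theorem sqrt_unique {y s : E} (hy : y ∈ J.K) (hs : s ∈ J.K)
    (h : J.jmul y y = J.jmul s s) : y = s := by
  have hprod : J.jmul (y - s) (y + s) = 0 := by
    simp only [map_add, map_sub, LinearMap.sub_apply, J.comm s y, h]
    abel
  have hsum : ⟪J.jmul (y - s) (y - s), y⟫ + ⟪J.jmul (y - s) (y - s), s⟫ = 0 := by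
    rw [← inner_add_right, J.inner_jmul_left, hprod, inner_zero_right]
  have h₁ := inner_sq_nonneg hy (y - s)
  have h₂ := inner_sq_nonneg hs (y - s)
  have k₁ := jmul_eq_zero_of_inner_sq_eq_zero hy (a := y - s) (by linarith)
  have k₂ := jmul_eq_zero_of_inner_sq_eq_zero hs (a := y - s) (by linarith)
  refine sub_eq_zero.1 (eq_zero_of_sq_eq_zero (J := J) ?_)
  rw [map_sub, k₁, k₂, sub_zero]

/-- Every element of the symmetric cone has a square root in the cone. -/
theorem exists_sqrt {z : E} (hz : z ∈ J.K) : ∃ y ∈ J.K, J.jmul y y = z := by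
  obtain ⟨c, σ, hc, rfl⟩ := exists_frame_sq_of_mem_K hz
  refine ⟨∑ i, |σ i| • c i, ⟨∑ i, √|σ i| • c i, ?_⟩, ?_⟩
  · rw [hc.jmul_sum]
    simp
  · rw [hc.jmul_sum]
    simp

theorem continuous_jmul : Continuous fun p : E × E => J.jmul p.1 p.2 := by
  let B : E →L[ℝ] E →L[ℝ] E := LinearMap.toContinuousLinearMap
    ((LinearMap.toContinuousLinearMap : (E →ₗ[ℝ] E) ≃ₗ[ℝ] (E →L[ℝ] E)).toLinearMap ∘ₗ J.jmul)
  exact (B.continuous.comp continuous_fst).clm_apply continuous_snd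

theorem norm_sq_le_of_jmul_self (y : E) : ‖y‖ ^ 2 ≤ ‖J.jmul y y‖ * ‖J.unit‖ := by
  rw [norm_sq_eq_inner_unit (J := J)]
  exact real_inner_le_norm _ _

open Filter Topology in
/-- An ultrafilter along which squares converge makes the elements converge. -/
theorem exists_tendsto_of_tendsto_sq {α : Type*} (U : Ultrafilter α) {y : α → E} {z : E}
    (h : Tendsto (fun a => J.jmul (y a) (y a)) U (𝓝 z)) :
    ∃ l, Tendsto y U (𝓝 l) ∧ J.jmul l l = z := by
  set C := (‖z‖ + 1) * ‖J.unit‖ + 1 with hC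
  have hev : ∀ᶠ a in (U : Filter α), y a ∈ Metric.closedBall (0 : E) C := by
    filter_upwards [h.norm.eventually (gt_mem_nhds (lt_add_one ‖z‖))] with a ha
    rw [mem_closedBall_zero_iff]
    have h₁ := norm_sq_le_of_jmul_self (J := J) (y a)
    have h₂ : ‖J.jmul (y a) (y a)‖ * ‖J.unit‖ ≤ (‖z‖ + 1) * ‖J.unit‖ := by gcongr
    nlinarith [norm_nonneg (y a), sq_nonneg (‖y a‖ - 1)]
  obtain ⟨l, -, hl⟩ := (isCompact_closedBall (0 : E) C).ultrafilter_le_nhds (U.map y)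
    (le_principal_iff.2 hev)
  have hl' : Tendsto y U (𝓝 l) := hl
  exact ⟨l, hl', tendsto_nhds_unique ((continuous_jmul.tendsto (l, l)).comp
    (hl'.prodMk_nhds hl')) h⟩

theorem isClosed_K : IsClosed J.K := by
  rw [isClosed_iff_ultrafilter]
  intro z U hU hK
  choose! y hy using fun (b : E) (hb : b ∈ J.K) => hb
  obtain ⟨l, -, hl⟩ := exists_tendsto_of_tendsto_sq (J := J) U (y := y) (z := z) <| by
    refine Filter.Tendsto.congr' ?_ (show Filter.Tendsto id U (nhds z) from hU)
    filter_upwards [hK] with b hb using hy b hb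
  exact ⟨l, hl.symm⟩

open Filter Topology in
/-- The square root on the symmetric cone is continuous. -/
theorem tendsto_sqrt {α : Type*} (U : Ultrafilter α) {y : α → E} {s : E} (hs : s ∈ J.K)
    (hy : ∀ᶠ a in (U : Filter α), y a ∈ J.K)
    (h : Tendsto (fun a => J.jmul (y a) (y a)) U (𝓝 (J.jmul s s))) :
    Tendsto y U (𝓝 s) := by
  obtain ⟨l, hl, hsq⟩ := exists_tendsto_of_tendsto_sq U h
  rwa [← sqrt_unique (isClosed_K.mem_of_tendsto hl hy) hs hsq]

theorem norm_sq_unit : ‖J.unit‖ ^ 2 = J.rank := by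
  obtain ⟨c, -, hc, -⟩ := J.exists_frame 0
  have := hc.inner_sum_sum (fun _ => 1) (fun _ => 1)
  simp only [one_smul, hc.2.2] at this
  rw [← real_inner_self_eq_norm_sq, this]
  simp

/-- The support idempotent of an element of the cone. -/
theorem HasRank.exists_support {b : E} {k : ℕ} (hb : b ∈ J.K) (h : J.HasRank b k) :
    ∃ p : E, J.jmul p p = p ∧ J.jmul b p = b ∧ ⟪p, J.unit⟫ = (k : ℝ) ∧
      ∀ a ∈ J.K, ⟪a, b⟫ = 0 → J.jmul a p = 0 := by
  obtain ⟨c, σ, hc, rfl, rfl⟩ := h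
  refine ⟨∑ i, (if σ i ≠ 0 then (1 : ℝ) else 0) • c i, ?_, ?_, ?_, fun a ha hab => ?_⟩
  · rw [hc.jmul_sum]
    exact Finset.sum_congr rfl fun i _ => by split_ifs <;> simp
  · rw [hc.jmul_sum]
    exact Finset.sum_congr rfl fun i _ => by by_cases h0 : σ i = 0 <;> simp [h0]
  · have := hc.inner_sum_sum (fun i => if σ i ≠ 0 then (1 : ℝ) else 0) (fun _ => 1)
    simp only [one_smul, hc.2.2] at this
    rw [this, Finset.card_filter]
    push_cast
    simp only [mul_one]
  · have hσ : ∀ i, 0 ≤ σ i := fun i => by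
      have := inner_sq_nonneg hb (c i)
      rwa [hc.jmul_self, real_inner_comm, hc.inner_sum_left] at this
    have hac : ∀ i, 0 ≤ ⟪a, c i⟫ := fun i =>
      inner_nonneg_of_mem_K ha (idempotent_mem_K (hc.jmul_self i))
    simp only [inner_sum, inner_smul_right] at hab
    rw [Finset.sum_eq_zero_iff_of_nonneg fun i _ => mul_nonneg (hσ i) (hac i)] at hab
    rw [map_sum]
    refine Finset.sum_eq_zero fun i hi => ?_
    by_cases h0 : σ i = 0
    · simp [h0]
    · rw [map_smul, jmul_eq_zero_of_inner_eq_zero ha (idempotent_mem_K (hc.jmul_self i))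
        ((mul_eq_zero.1 (hab i hi)).resolve_left h0), smul_zero]

/-- If no nonzero idempotent annihilates both `b` and `d`, then the complementary elements
`b` and `d` of the cone are strictly complementary. -/
theorem rank_add_rank_eq {b d : E} {kb kd : ℕ} (hb : b ∈ J.K) (hd : d ∈ J.K)
    (hbd : J.jmul d b = 0) (hkb : J.HasRank b kb) (hkd : J.HasRank d kd)
    (H : ∀ u, J.jmul u u = u → J.jmul u b = 0 → J.jmul u d = 0 → u = 0) :
    kb + kd = J.rank := by
  obtain ⟨p, hp, hbp, hpk, hpz⟩ := hkb.exists_support hb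
  obtain ⟨q, hq, hdq, hqk, hqz⟩ := hkd.exists_support hd
  have hdb : ⟪d, b⟫ = 0 := by rw [← J.inner_jmul_unit, hbd, inner_zero_left]
  have hdp : J.jmul d p = 0 := hpz d hd hdb
  have hqb : J.jmul b q = 0 := hqz b hb (by rwa [real_inner_comm])
  have hpq : J.jmul p q = 0 := hqz p (idempotent_mem_K hp) <| by
    rw [← J.inner_jmul_unit, J.comm, hdp, inner_zero_left]
  have hu := H (J.unit - p - q)
    (by simp only [map_sub, LinearMap.sub_apply, J.unit_jmul, J.unit_jmul_right, hp, hq, hpq,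
          J.comm q p]; abel)
    (by simp only [map_sub, LinearMap.sub_apply, J.unit_jmul, J.comm p b, J.comm q b, hbp, hqb]; abel)
    (by simp only [map_sub, LinearMap.sub_apply, J.unit_jmul, J.comm p d, J.comm q d, hdp, hdq]
        abel)
  have hr : ⟪J.unit - p - q, J.unit⟫ = 0 := by rw [hu, inner_zero_left]
  rw [inner_sub_left, inner_sub_left, real_inner_self_eq_norm_sq, norm_sq_unit, hpk, hqk] at hr
  have : ((kb + kd : ℕ) : ℝ) = J.rank := by push_cast; linarith
  exact_mod_cast this

end EJA

section Analysis

open Filter Topology Asymptotics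

/-- Second order Taylor expansion at a critical point. -/
theorem isLittleO_taylor_two_of_fderiv_eq_zero {F : Type*} [NormedAddCommGroup F]
    [NormedSpace ℝ F] {φ : F → ℝ} (hφ : ContDiff ℝ 2 φ) {x : F} (h0 : fderiv ℝ φ x = 0) :
    (fun z => φ z - φ x - (1 / 2 : ℝ) * iteratedFDeriv ℝ 2 φ x ![z - x, z - x])
      =o[𝓝 x] fun z => ‖z - x‖ ^ 2 := by
  have hdiff : Differentiable ℝ φ := hφ.differentiable (by norm_num)
  have hdiff' : Differentiable ℝ (fderiv ℝ φ) :=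
    (hφ.fderiv_right (m := 1) (by norm_num)).differentiable (by norm_num)
  set A := fderiv ℝ (fderiv ℝ φ) x with hA
  have hsymm : ∀ u v, A u v = A v u :=
    hφ.contDiffAt.isSymmSndFDerivAt (by simp)
  have hψ : ∀ z, HasFDerivAt (fun z => φ z - (1 / 2 : ℝ) * A (z - x) (z - x))
      (fderiv ℝ φ z - A (z - x)) z := by
    intro z
    have hsub : HasFDerivAt (fun z => z - x) (ContinuousLinearMap.id ℝ F) z :=
      (hasFDerivAt_id z).sub_const x
    have hq := (A.hasFDerivAt.comp z hsub).clm_apply hsub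
    refine ((hdiff z).hasFDerivAt.sub (hq.const_mul (1 / 2 : ℝ))).congr_fderiv ?_
    ext u
    have hu := hsymm u (z - x)
    simp only [ContinuousLinearMap.comp_id, Function.comp_apply, sub_apply, smul_apply,
      add_apply, ContinuousLinearMap.flip_apply, hu, smul_eq_mul]
    ring
  have hlin := (hdiff' x).hasFDerivAt.isLittleO
  simp only [h0, sub_zero] at hlin
  rw [isLittleO_iff]
  intro ε hε
  obtain ⟨δ, hδ, hball⟩ := Metric.eventually_nhds_iff_ball.1 (isLittleO_iff.1 hlin hε)
  filter_upwards [Metric.ball_mem_nhds x hδ] with z hz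
  have hsub : Metric.closedBall x ‖z - x‖ ⊆ Metric.ball x δ :=
    Metric.closedBall_subset_ball (by rwa [← dist_eq_norm])
  have hbound := (convex_closedBall x ‖z - x‖).norm_image_sub_le_of_norm_hasFDerivWithin_le
    (C := ε * ‖z - x‖)
    (fun y _ => (hψ y).hasFDerivWithinAt)
    (fun y hy => (hball y (hsub hy)).trans (by
      gcongr; rwa [← dist_eq_norm]))
    (Metric.mem_closedBall_self (norm_nonneg _))
    (show z ∈ Metric.closedBall x ‖z - x‖ by simp [dist_eq_norm])
  rw [iteratedFDeriv_two_apply]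
  simp only [sub_self, map_zero, mul_zero, sub_zero] at hbound
  rw [norm_pow, norm_norm, sq, ← mul_assoc]
  refine le_trans (le_of_eq ?_) hbound
  congr 1
  simp only [Matrix.cons_val_zero, Matrix.cons_val_one, ← hA]
  ring

end Analysis

namespace EJA

theorem contDiff_lagr {E : Type*} [NormedAddCommGroup E] [InnerProductSpace ℝ E] {n m : ℕ}
    {f : EuclideanSpace ℝ (Fin n) → ℝ}
    {h : EuclideanSpace ℝ (Fin n) → EuclideanSpace ℝ (Fin m)}
    {g : EuclideanSpace ℝ (Fin n) → E}
    (hf : ContDiff ℝ 2 f) (hh : ContDiff ℝ 2 h) (hg : ContDiff ℝ 2 g)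
    (μ : EuclideanSpace ℝ (Fin m)) (lam : E) : ContDiff ℝ 2 (lagr f h g μ lam) :=
  (hf.sub (hh.inner ℝ contDiff_const)).sub (hg.inner ℝ contDiff_const)

variable {E : Type*} [NormedAddCommGroup E] [InnerProductSpace ℝ E]
  [FiniteDimensional ℝ E] {J : EJA E} {n m : ℕ}
  {f : EuclideanSpace ℝ (Fin n) → ℝ}
  {h : EuclideanSpace ℝ (Fin n) → EuclideanSpace ℝ (Fin m)}
  {g : EuclideanSpace ℝ (Fin n) → E}
  {x : EuclideanSpace ℝ (Fin n)} {μ : EuclideanSpace ℝ (Fin m)} {lam : E}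

/-- The Lagrangian is stationary at a KKT triple. -/
theorem KKTP1.fderiv_lagr_eq_zero (hf : DifferentiableAt ℝ f x) (hh : DifferentiableAt ℝ h x)
    (hg : DifferentiableAt ℝ g x) (hKKT : J.KKTP1 f h g x μ lam) :
    fderiv ℝ (lagr f h g μ lam) x = 0 := by
  have hd := (hf.hasFDerivAt.sub (hh.hasFDerivAt.inner ℝ (hasFDerivAt_const μ x))).sub
    (hg.hasFDerivAt.inner ℝ (hasFDerivAt_const lam x))
  have hd' : HasFDerivAt (lagr f h g μ lam) _ x := hd
  rw [hd'.fderiv]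
  ext v
  have hv := congrArg (fun u => ⟪u, v⟫) hKKT.1
  simp only [inner_sub_left, inner_zero_left, ContinuousLinearMap.adjoint_inner_left,
    gradient, InnerProductSpace.toDual_symm_apply] at hv
  simpa [real_inner_comm] using hv

open Filter Topology Asymptotics in
/-- Second order sufficiency through squared slack variables. -/
theorem isLocalMinOn_of_sosc (hf : ContDiff ℝ 2 f) (hh : ContDiff ℝ 2 h) (hg : ContDiff ℝ 2 g)
    (hKKT : J.KKTP1 f h g x μ lam) {s : E} (hsK : s ∈ J.K) (hs : J.jmul s s = g x)
    (hslam : J.jmul s lam = 0)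
    (hsosc : ∀ (v : EuclideanSpace ℝ (Fin n)) (w : E), (v, w) ≠ (0, 0) →
      fderiv ℝ g x v - (2 : ℝ) • J.jmul s w = 0 → fderiv ℝ h x v = 0 →
      0 < iteratedFDeriv ℝ 2 (lagr f h g μ lam) x ![v, v] + 2 * ⟪J.jmul w w, lam⟫) :
    IsLocalMinOn f {x' | h x' = 0 ∧ g x' ∈ J.K} x := by
  have hf₁ : Differentiable ℝ f := hf.differentiable (by norm_num)
  have hh₁ : Differentiable ℝ h := hh.differentiable (by norm_num)
  have hg₁ : Differentiable ℝ g := hg.differentiable (by norm_num)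
  by_contra hcon
  obtain ⟨U, hU⟩ : ∃ U : Ultrafilter (EuclideanSpace ℝ (Fin n)),
      (U : Filter _) ≤ 𝓝[{x' | h x' = 0 ∧ g x' ∈ J.K}] x ⊓ 𝓟 {x' | ¬ f x ≤ f x'} := by
    have : (𝓝[{x' | h x' = 0 ∧ g x' ∈ J.K}] x ⊓ 𝓟 {x' | ¬ f x ≤ f x'}).NeBot :=
      frequently_mem_iff_neBot.1 (not_eventually.1 hcon)
    exact Ultrafilter.exists_le _
  have hUx : (U : Filter _) ≤ 𝓝 x := hU.trans (inf_le_left.trans nhdsWithin_le_nhds)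
  have hfeas : ∀ᶠ z in (U : Filter _), h z = 0 ∧ g z ∈ J.K :=
    (hU.trans inf_le_left) self_mem_nhdsWithin
  have hlt : ∀ᶠ z in (U : Filter _), f z < f x := by
    filter_upwards [(hU.trans inf_le_right) (mem_principal_self _)] with z hz
    exact not_le.1 hz
  choose! y hyK hysq using fun (z : E) (hz : z ∈ J.K) => exists_sqrt hz
  have hy : Tendsto (fun z => y (g z)) U (𝓝 s) := by
    refine tendsto_sqrt U hsK (hfeas.mono fun z hz => hyK _ hz.2) ?_
    rw [hs]
    refine Tendsto.congr' ?_ ((hg.continuous.tendsto x).mono_left hUx)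
    filter_upwards [hfeas] with z hz using (hysq _ hz.2).symm
  -- the displacement in the space of pairs, its size and its direction
  set P : EuclideanSpace ℝ (Fin n) → EuclideanSpace ℝ (Fin n) × E :=
    fun z => (z - x, y (g z) - s)
  have hPne : ∀ᶠ z in (U : Filter _), ‖P z‖ ≠ 0 := by
    filter_upwards [hlt] with z hz h0
    have : z - x = 0 := congrArg Prod.fst (norm_eq_zero.1 h0)
    rw [sub_eq_zero.1 this] at hz
    exact lt_irrefl _ hz
  obtain ⟨⟨v, w⟩, hvw, hlim⟩ := (isCompact_sphere
    (0 : EuclideanSpace ℝ (Fin n) × E) 1).ultrafilter_le_nhds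
    (U.map fun z => ‖P z‖⁻¹ • P z) (le_principal_iff.2 (Ultrafilter.mem_map.2 (by
      filter_upwards [hPne] with z hz
      simp [norm_smul, hz])))
  replace hlim : Tendsto (fun z => ‖P z‖⁻¹ • P z) U (𝓝 (v, w)) := hlim
  have hv : Tendsto (fun z => ‖P z‖⁻¹ • (z - x)) U (𝓝 v) :=
    (continuous_fst.tendsto (v, w)).comp hlim
  have hw : Tendsto (fun z => ‖P z‖⁻¹ • (y (g z) - s)) U (𝓝 w) :=
    (continuous_snd.tendsto (v, w)).comp hlim
  have hne : (v, w) ≠ (0, 0) := by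
    intro h0
    rw [h0] at hvw
    simp at hvw
  have hOx : (fun z => z - x) =O[U] fun z => ‖P z‖ :=
    isBigO_of_le _ fun z => by simpa using norm_fst_le (P z)
  -- the linearized constraints hold in the limit
  have hDh : fderiv ℝ h x v = 0 := by
    have h₁ := (((hh₁ x).hasFDerivAt.isLittleO.mono hUx).trans_isBigO
      hOx).tendsto_inv_smul_nhds_zero.neg
    rw [neg_zero] at h₁
    have h₂ := ((fderiv ℝ h x).continuous.tendsto v).comp hv
    refine tendsto_nhds_unique h₂ (Tendsto.congr' ?_ h₁)
    filter_upwards [hfeas] with z hz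
    rw [hz.1, hKKT.2.2.2.2, Function.comp_apply, map_smul]
    module
  have hDg : fderiv ℝ g x v - (2 : ℝ) • J.jmul s w = 0 := by
    have h₁ := (((hg₁ x).hasFDerivAt.isLittleO.mono hUx).trans_isBigO
      hOx).tendsto_inv_smul_nhds_zero
    have h₂ := ((fderiv ℝ g x).continuous.tendsto v).comp hv
    have h₃ := (continuous_jmul (J := J)).tendsto (s, w) |>.comp
      ((tendsto_const_nhds (x := s)).prodMk_nhds hw)
    have h₄ := (continuous_jmul (J := J)).tendsto (s - s, w) |>.comp
      ((hy.sub_const s).prodMk_nhds hw)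
    refine tendsto_nhds_unique (h₂.sub (h₃.const_smul (2 : ℝ)))
      (Tendsto.congr' ?_ (by simpa using h₄.sub h₁))
    filter_upwards [hfeas] with z hz
    have hgz := hysq _ hz.2
    simp only [Function.comp_apply, map_smul, map_sub, ← hs]
    rw [hgz, J.comm (y (g z)) s]
    module
  -- the second order expansion of the objective
  have hL := ((isLittleO_taylor_two_of_fderiv_eq_zero (contDiff_lagr hf hh hg μ lam)
    (hKKT.fderiv_lagr_eq_zero (hf₁ x) (hh₁ x) (hg₁ x))).mono hUx).trans_isBigO
      (hOx.norm_left.pow 2)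
  have hL' := hL.tendsto_inv_smul_nhds_zero
  have hcontD : Continuous fun u : EuclideanSpace ℝ (Fin n) =>
      iteratedFDeriv ℝ 2 (lagr f h g μ lam) x ![u, u] :=
    (iteratedFDeriv ℝ 2 (lagr f h g μ lam) x).cont.comp (by fun_prop)
  have hcontw : Continuous fun u : E => ⟪J.jmul u u, lam⟫ :=
    ((continuous_jmul (J := J)).comp (continuous_id.prodMk continuous_id)).inner continuous_const
  have hD := ((hcontD.tendsto v).comp hv).const_mul (1 / 2 : ℝ)
  have hW := (hcontw.tendsto w).comp hw
  have hle := le_of_tendsto ((hL'.add hD).add hW) (b := 0) <| by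
    filter_upwards [hfeas, hlt, hPne] with z hz hfz ht
    have hsl : ⟪J.jmul s (y (g z)), lam⟫ = 0 := by
      rw [J.inner_jmul_left, hslam, inner_zero_right]
    have hsl' : ⟪J.jmul s s, lam⟫ = 0 := by
      rw [J.inner_jmul_left, hslam, inner_zero_right]
    have hsmul : iteratedFDeriv ℝ 2 (lagr f h g μ lam) x
        ![‖P z‖⁻¹ • (z - x), ‖P z‖⁻¹ • (z - x)] = (‖P z‖ ^ 2)⁻¹ *
          iteratedFDeriv ℝ 2 (lagr f h g μ lam) x ![z - x, z - x] := by
      simp only [iteratedFDeriv_two_apply, Matrix.cons_val_zero, Matrix.cons_val_one, map_smul,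
        smul_apply, smul_eq_mul]
      ring
    have hquad : ⟪J.jmul (y (g z) - s) (y (g z) - s), lam⟫ = ⟪g z, lam⟫ := by
      simp only [map_sub, LinearMap.sub_apply, J.comm (y (g z)) s, inner_sub_left, hsl, hsl',
        hysq _ hz.2]
      ring
    have hlagr : lagr f h g μ lam z - lagr f h g μ lam x = f z - f x - ⟪g z, lam⟫ := by
      simp only [lagr, hz.1, hKKT.2.2.2.2, ← hs, hsl', inner_zero_left]
      ring
    simp only [Function.comp_apply, hsmul, map_smul, LinearMap.smul_apply, inner_smul_left,
      hquad, hlagr, RCLike.conj_to_real, smul_eq_mul]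
    have hpos : 0 ≤ (‖P z‖ ^ 2)⁻¹ := by positivity
    calc _ = (‖P z‖ ^ 2)⁻¹ * (f z - f x) := by ring
      _ ≤ 0 := mul_nonpos_of_nonneg_of_nonpos hpos (by linarith)
  have := hsosc v w hne hDg hDh
  linarith

end EJA

/-- the second order sufficient condition via slack variables:
a KKT triple of (P1) satisfying SOSC-NSCP gives a local minimum of (P1) and
strict complementarity. -/
theorem stmt14 {E : Type*} [NormedAddCommGroup E] [InnerProductSpace ℝ E]
    [FiniteDimensional ℝ E] (J : EJA E) {n m : ℕ}
    (f : EuclideanSpace ℝ (Fin n) → ℝ)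
    (h : EuclideanSpace ℝ (Fin n) → EuclideanSpace ℝ (Fin m))
    (g : EuclideanSpace ℝ (Fin n) → E)
    (hf : ContDiff ℝ 2 f) (hh : ContDiff ℝ 2 h) (hg : ContDiff ℝ 2 g)
    (x : EuclideanSpace ℝ (Fin n)) (μ : EuclideanSpace ℝ (Fin m)) (lam : E)
    (hKKT : J.KKTP1 f h g x μ lam)
    (s : E) (hsK : s ∈ J.K) (hs : J.jmul s s = g x)
    (hsosc : ∀ (v : EuclideanSpace ℝ (Fin n)) (w : E), (v, w) ≠ (0, 0) →
      fderiv ℝ g x v - (2 : ℝ) • J.jmul s w = 0 → fderiv ℝ h x v = 0 →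
      0 < iteratedFDeriv ℝ 2 (EJA.lagr f h g μ lam) x ![v, v]
          + 2 * ⟪J.jmul w w, lam⟫) :
    IsLocalMinOn f {x' : EuclideanSpace ℝ (Fin n) | h x' = 0 ∧ g x' ∈ J.K} x ∧
      ∀ kg kl : ℕ, J.HasRank (g x) kg → J.HasRank lam kl →
        kg + kl = J.rank := by
  have hlam := hKKT.2.1
  have hgK := hKKT.2.2.1
  have hcompl := hKKT.2.2.2.1
  have hslam : J.jmul s lam = 0 := by
    refine EJA.jmul_eq_zero_of_inner_sq_eq_zero hlam ?_
    rw [hs, real_inner_comm, ← J.inner_jmul_unit, hcompl, inner_zero_left]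
  refine ⟨EJA.isLocalMinOn_of_sosc hf hh hg hKKT hsK hs hslam hsosc, fun kg kl hkg hkl =>
    EJA.rank_add_rank_eq hgK hlam hcompl hkg hkl fun u hu hug hul => ?_⟩
  by_contra hu0
  have hsu : J.jmul s u = 0 := by
    refine EJA.jmul_eq_zero_of_inner_sq_eq_zero (EJA.idempotent_mem_K hu) ?_
    rw [hs, real_inner_comm, ← J.inner_jmul_unit, hug, inner_zero_left]
  have hpos := hsosc 0 u (by simpa using hu0) (by simp [hsu]) (map_zero _)
  rw [hu, ← J.inner_jmul_unit, hul, inner_zero_left, iteratedFDeriv_two_apply] at hpos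
  simp at hpos
end
end

section
/- Let x ∈ ℝⁿ be a local minimum of problem (P1) and let (x, μ, λ) ∈ ℝⁿ × ℝᵐ × E be a KKT triple of (P1) such that x is nondegenerate (for all v ∈ ℝᵐ and w ∈ E, w ∈ (lin T_K(g(x)))^⊥ and Dg(x)*w + Dh(x)*v = 0 imply w = 0 and v = 0). Then ⟨∇²_x L(x,μ,λ)v, v⟩ + 2⟨w∘w, λ⟩ ≥ 0 for every (v, w) ∈ ℝⁿ × E such that Dg(x)v − 2 √(g(x))∘w = 0 and Dh(x)v = 0. -/
open scoped RealInnerProductSpace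

noncomputable section

open Filter Topology Asymptotics

section Calculus

variable {X : Type*} [NormedAddCommGroup X] [NormedSpace ℝ X]

/-- Second-order Taylor expansion at a critical point. -/
theorem ContDiff.taylor_two_isLittleO_of_fderiv_eq_zero {φ : X → ℝ} (hφ : ContDiff ℝ 2 φ) {x : X}
    (hx : fderiv ℝ φ x = 0) :
    (fun y => φ y - φ x - (1 / 2 : ℝ) * fderiv ℝ (fderiv ℝ φ) x (y - x) (y - x))
      =o[𝓝 x] fun y => ‖y - x‖ ^ 2 := by
  set B := fderiv ℝ (fderiv ℝ φ) x
  have hsymm : ∀ a b, B a b = B b a := fun a b =>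
    hφ.contDiffAt.isSymmSndFDerivAt (by simp) a b
  have hd : ∀ y, HasFDerivAt φ (fderiv ℝ φ y) y := fun y =>
    (hφ.differentiable (by norm_num) y).hasFDerivAt
  have hdd : HasFDerivAt (fderiv ℝ φ) B x :=
    ((hφ.fderiv_right (m := 1) (by norm_num)).differentiable (by norm_num) x).hasFDerivAt
  have hder : ∀ y ∈ (Set.univ : Set X),
      HasFDerivWithinAt (fun y => φ y - (1 / 2 : ℝ) * B (y - x) (y - x))
        (fderiv ℝ φ y - B (y - x)) Set.univ y := by
    intro y _
    have h1 : HasFDerivAt (fun y : X => y - x) (ContinuousLinearMap.id ℝ X) y :=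
      (hasFDerivAt_id y).sub_const x
    have h2 := (B.hasFDerivAt.comp y h1).clm_apply h1
    refine (((hd y).sub (h2.const_mul (1 / 2 : ℝ))).congr_fderiv ?_).hasFDerivWithinAt
    ext a
    have := hsymm a (y - x)
    simp only [map_sub, sub_apply] at this
    simp
    linarith
  have hlo : (fun y => fderiv ℝ φ y - B (y - x)) =o[𝓝[Set.univ] x] fun y => ‖y - x‖ ^ 1 := by
    have := hdd.isLittleO
    simpa [hx] using this.norm_right
  have key := convex_univ.isLittleO_pow_succ (Set.mem_univ x) hder hlo
  rw [nhdsWithin_univ] at key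
  refine key.congr_left fun y => ?_
  simp
  ring

/-- Along a curve with velocity `v` issuing from a critical point, the second-order difference
quotient converges to half the second derivative in the direction `v`. -/
theorem ContDiff.tendsto_second_order_quotient {φ : X → ℝ} (hφ : ContDiff ℝ 2 φ) {x v : X}
    (hx : fderiv ℝ φ x = 0) {γ : ℝ → X} (hγ : HasDerivAt γ v 0) (hγ0 : γ 0 = x) :
    Tendsto (fun t => (φ (γ t) - φ x) / t ^ 2) (𝓝[≠] 0)
      (𝓝 ((1 / 2 : ℝ) * fderiv ℝ (fderiv ℝ φ) x v v)) := by
  set B := fderiv ℝ (fderiv ℝ φ) x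
  have hslope : Tendsto (fun t : ℝ => t⁻¹ • (γ t - x)) (𝓝[≠] 0) (𝓝 v) := by
    simpa [hγ0] using hasDerivAt_iff_tendsto_slope_zero.1 hγ
  have hcont : Tendsto γ (𝓝[≠] 0) (𝓝 x) := by
    have := hγ.continuousAt.tendsto
    rw [hγ0] at this
    exact this.mono_left nhdsWithin_le_nhds
  have hO : (fun t => γ t - x) =O[𝓝[≠] 0] fun t : ℝ => t := by
    have := hγ.isBigO_sub
    simp only [hγ0, sub_zero] at this
    exact this.mono nhdsWithin_le_nhds
  have hrem : Tendsto (fun t => (φ (γ t) - φ x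
      - (1 / 2 : ℝ) * B (γ t - x) (γ t - x)) / t ^ 2) (𝓝[≠] 0) (𝓝 0) :=
    (((hφ.taylor_two_isLittleO_of_fderiv_eq_zero hx).comp_tendsto hcont).trans_isBigO
      (hO.norm_left.pow 2)).tendsto_div_nhds_zero
  have hquad : Tendsto (fun t : ℝ => (1 / 2 : ℝ) * B (t⁻¹ • (γ t - x)) (t⁻¹ • (γ t - x)))
      (𝓝[≠] 0) (𝓝 ((1 / 2 : ℝ) * B v v)) :=
    ((B.continuous₂.tendsto (v, v)).comp (hslope.prodMk_nhds hslope)).const_mul _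
  have hsum := hrem.add hquad
  rw [zero_add] at hsum
  refine hsum.congr' ?_
  filter_upwards [self_mem_nhdsWithin] with t ht
  have ht' : t ≠ 0 := ht
  simp only [map_smul, smul_eq_mul, smul_apply]
  field_simp
  ring

/-- A kernel vector of a surjective strict derivative is the velocity of a curve inside the
level set. -/
theorem HasStrictFDerivAt.exists_curve_of_mem_ker [CompleteSpace X] {Y : Type*}
    [NormedAddCommGroup Y] [NormedSpace ℝ Y] [FiniteDimensional ℝ Y] {G : X → Y} {G' : X →L[ℝ] Y}
    {p : X} (hG : HasStrictFDerivAt G G' p) (hsurj : G'.range = ⊤) {d : X} (hd : G' d = 0) :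
    ∃ γ : ℝ → X, γ 0 = p ∧ HasDerivAt γ d 0 ∧ ∀ᶠ t in 𝓝 0, G (γ t) = G p := by
  let d' : G'.ker := ⟨d, hd⟩
  have hline : HasDerivAt (fun t : ℝ => t • d') d' 0 := by
    simpa using (hasDerivAt_id (0 : ℝ)).smul_const d'
  refine ⟨fun t => hG.implicitFunction G G' hsurj (G p) (t • d'), by simp, ?_, ?_⟩
  · have h1 : HasFDerivAt (hG.implicitFunction G G' hsurj (G p)) G'.ker.subtypeL
        ((fun t : ℝ => t • d') 0) := by
      simpa using (hG.to_implicitFunction hsurj).hasFDerivAt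
    exact h1.comp_hasDerivAt (0 : ℝ) hline
  · have ht : Tendsto (fun t : ℝ => (G p, t • d')) (𝓝 0) (𝓝 (G p, (0 : G'.ker))) := by
      refine tendsto_const_nhds.prodMk_nhds ?_
      simpa using hline.continuousAt.tendsto
    exact ht.eventually (hG.map_implicitFunction_eq hsurj)

end Calculus

/-- A map into a product of finite-dimensional inner product spaces is onto if only the zero pair
is orthogonal to its range. -/
theorem LinearMap.range_eq_top_of_forall_inner_add_eq_zero {X F E : Type*} [AddCommGroup X]
    [Module ℝ X] [NormedAddCommGroup F] [InnerProductSpace ℝ F] [FiniteDimensional ℝ F]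
    [NormedAddCommGroup E] [InnerProductSpace ℝ E] [FiniteDimensional ℝ E]
    (A : X →ₗ[ℝ] F × E)
    (hA : ∀ (a : F) (b : E), (∀ z, ⟪a, (A z).1⟫ + ⟪b, (A z).2⟫ = 0) → a = 0 ∧ b = 0) :
    LinearMap.range A = ⊤ := by
  by_contra hne
  obtain ⟨ℓ, hℓ, hle⟩ := Submodule.exists_le_ker_of_lt_top _ (lt_top_iff_ne_top.2 hne)
  let a := (InnerProductSpace.toDual ℝ F).symm
    (LinearMap.toContinuousLinearMap (ℓ ∘ₗ LinearMap.inl ℝ F E))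
  let b := (InnerProductSpace.toDual ℝ E).symm
    (LinearMap.toContinuousLinearMap (ℓ ∘ₗ LinearMap.inr ℝ F E))
  have hab : ∀ q : F × E, ⟪a, q.1⟫ + ⟪b, q.2⟫ = ℓ q := by
    intro q
    simp [a, b, ← map_add]
  obtain ⟨ha, hb⟩ := hA a b fun z => by
    rw [hab]
    exact hle ⟨z, rfl⟩
  apply hℓ
  ext q <;> simp [← hab, ha, hb]

namespace EJA

variable {E : Type*} [NormedAddCommGroup E] [InnerProductSpace ℝ E]
  [FiniteDimensional ℝ E] (J : EJA E)

/-- The Peirce polynomial of multiplication by an idempotent. -/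
theorem IsIdempotent.peirce {c : E} (hc : J.IsIdempotent c) (v : E) :
    (2 : ℝ) • J.jmul c (J.jmul c (J.jmul c v)) - (3 : ℝ) • J.jmul c (J.jmul c v) + J.jmul c v
      = 0 := by
  have hc' : J.jmul c c = c := hc
  have h1 := J.jordan (c + v) c
  have h2 := J.jordan (c - v) c
  have h3 := J.jordan v c
  simp only [map_add, map_sub, LinearMap.add_apply, LinearMap.sub_apply, hc', J.comm v c]
    at h1 h2 h3
  rw [J.comm (J.jmul c v) c] at h1 h2
  linear_combination (norm := module) (1 / 2 : ℝ) • h1 - (1 / 2 : ℝ) • h2 - h3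

theorem IsIdempotent.inner_jmul_self {c : E} (hc : J.IsIdempotent c) (v : E) :
    ⟪v, J.jmul c v⟫ = ‖J.jmul c v‖ ^ 2
      + 4 * ‖J.jmul c v - J.jmul c (J.jmul c v)‖ ^ 2 := by
  have hsa : ∀ a b : E, ⟪J.jmul c a, b⟫ = ⟪a, J.jmul c b⟫ := fun a b => by
    rw [J.comm c a, J.assoc_inner]
  have h1 := hc.peirce J v
  have h2 := hc.peirce J (J.jmul c v)
  have e1 := congrArg (fun u => ⟪v, u⟫) h1
  have e2 := congrArg (fun u => ⟪v, u⟫) h2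
  simp only [inner_add_right, inner_sub_right, inner_smul_right, inner_zero_right] at e1 e2
  rw [← real_inner_self_eq_norm_sq, ← real_inner_self_eq_norm_sq]
  simp only [inner_sub_left, inner_sub_right, hsa]
  linarith

theorem jmul_self_sum_smul {ι : Type*} [Fintype ι] {c : ι → E} (hc : ∀ i, J.IsIdempotent (c i))
    (horth : ∀ i j, i ≠ j → J.jmul (c i) (c j) = 0) (σ : ι → ℝ) :
    J.jmul (∑ i, σ i • c i) (∑ i, σ i • c i) = ∑ i, σ i ^ 2 • c i := by
  have hc' : ∀ i, J.jmul (c i) (c i) = c i := hc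
  simp only [map_sum, map_smul, LinearMap.sum_apply, LinearMap.smul_apply]
  refine Finset.sum_congr rfl fun i _ => ?_
  rw [Finset.sum_eq_single i]
  · rw [hc', smul_smul, sq]
  · intro j _ hj
    simp [horth j i hj]
  · simp

theorem mem_K_spectral {z : E} (hz : z ∈ J.K) :
    ∃ (c : Fin J.rank → E) (τ : Fin J.rank → ℝ), (∀ i, J.IsIdempotent (c i)) ∧ (∀ i, 0 ≤ τ i) ∧
      z = ∑ i, τ i • c i := by
  obtain ⟨y, rfl⟩ := hz
  obtain ⟨c, σ, hc, -, -, horth, -, rfl⟩ := J.spectral y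
  exact ⟨c, fun i => σ i ^ 2, hc, fun i => sq_nonneg _, J.jmul_self_sum_smul hc horth σ⟩

theorem inner_jmul_self_nonneg {z : E} (hz : z ∈ J.K) (v : E) : 0 ≤ ⟪v, J.jmul z v⟫ := by
  obtain ⟨c, τ, hc, hτ, rfl⟩ := J.mem_K_spectral hz
  simp only [map_sum, map_smul, LinearMap.sum_apply, LinearMap.smul_apply, inner_sum,
    inner_smul_right, (hc _).inner_jmul_self]
  exact Finset.sum_nonneg fun i _ => mul_nonneg (hτ i) (by positivity)

theorem jmul_eq_zero_of_inner_eq_zero_s15 {z : E} (hz : z ∈ J.K) {v : E}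
    (hv : ⟪v, J.jmul z v⟫ = 0) : J.jmul z v = 0 := by
  obtain ⟨c, τ, hc, hτ, rfl⟩ := J.mem_K_spectral hz
  simp only [map_sum, map_smul, LinearMap.sum_apply, LinearMap.smul_apply, inner_sum,
    inner_smul_right, (hc _).inner_jmul_self] at hv ⊢
  rw [Finset.sum_eq_zero_iff_of_nonneg fun i _ => mul_nonneg (hτ i) (by positivity)] at hv
  refine Finset.sum_eq_zero fun i hi => ?_
  rcases mul_eq_zero.1 (hv i hi) with h0 | h0
  · rw [h0, zero_smul]
  · have : ‖J.jmul (c i) v‖ ^ 2 = 0 := by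
      linarith [sq_nonneg (‖J.jmul (c i) v‖),
        sq_nonneg (‖J.jmul (c i) v - J.jmul (c i) (J.jmul (c i) v)‖)]
    rw [norm_eq_zero.1 (pow_eq_zero_iff two_ne_zero |>.1 this), smul_zero]

theorem inner_jmul_jmul (z v : E) : ⟪v, J.jmul z v⟫ = ⟪J.jmul v v, z⟫ := by
  rw [J.assoc_inner, J.comm]

theorem IsIdempotent.inner_nonneg {c z : E} (hc : J.IsIdempotent c) (hz : z ∈ J.K) :
    0 ≤ ⟪c, z⟫ := by
  have hcc : J.jmul c c = c := hc
  have := J.inner_jmul_self_nonneg hz c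
  rwa [inner_jmul_jmul, hcc] at this

/-- Elements annihilated by `s ∈ K` are orthogonal to the lineality space of the tangent cone
at `s ∘ s`. -/
theorem inner_linTangent_eq_zero {s w u : E} (hsK : s ∈ J.K) (hsw : J.jmul s w = 0)
    (hu : u ∈ J.linTangent (J.jmul s s)) : ⟪w, u⟫ = 0 := by
  obtain ⟨d, ω, hd, -, -, horth, -, hw⟩ := J.spectral w
  have hdI : ∀ i, J.IsIdempotent (d i) := hd
  have hsq : J.jmul w w = ∑ i, ω i ^ 2 • d i := by
    rw [hw]
    exact J.jmul_self_sum_smul hd horth ω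
  have hzero : ∑ i, ω i ^ 2 * ⟪d i, s⟫ = 0 := by
    have : ⟪J.jmul w w, s⟫ = 0 := by rw [← inner_jmul_jmul, hsw, inner_zero_right]
    simpa [hsq, sum_inner, inner_smul_left] using this
  rw [Finset.sum_eq_zero_iff_of_nonneg
    fun i _ => mul_nonneg (sq_nonneg _) ((hdI i).inner_nonneg J hsK)] at hzero
  rw [hw, sum_inner]
  refine Finset.sum_eq_zero fun i hi => ?_
  rw [inner_smul_left]
  rcases mul_eq_zero.1 (hzero i hi) with h0 | h0
  · simp [pow_eq_zero_iff two_ne_zero |>.1 h0]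
  have hsd : J.jmul s (d i) = 0 :=
    J.jmul_eq_zero_of_inner_eq_zero_s15 hsK (by rw [inner_jmul_jmul, hd, h0])
  have hss : ⟪d i, J.jmul s s⟫ = 0 := by
    rw [← J.assoc_inner, J.comm, hsd, inner_zero_left]
  have hT : ∀ a ∈ J.tangentCone (J.jmul s s), 0 ≤ ⟪d i, a⟫ := by
    have hclosed : IsClosed {a : E | 0 ≤ ⟪d i, a⟫} :=
      isClosed_le continuous_const (continuous_const.inner continuous_id)
    refine fun a ha => closure_minimal ?_ hclosed ha
    rintro _ ⟨t, ht, k, hk, rfl⟩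
    simp only [Set.mem_ofPred_eq, inner_smul_right, inner_sub_right, hss, sub_zero]
    exact mul_nonneg ht.le ((hdI i).inner_nonneg J hk)
  have h1 := hT u hu.1
  have h2 := hT (-u) hu.2
  rw [inner_neg_right] at h2
  rw [le_antisymm (by linarith) h1, mul_zero]

/-- The Jordan product as a continuous bilinear map. -/
def jmulL : E →L[ℝ] E →L[ℝ] E :=
  LinearMap.toContinuousLinearMap
    ((LinearMap.toContinuousLinearMap : (E →ₗ[ℝ] E) ≃ₗ[ℝ] E →L[ℝ] E).toLinearMap ∘ₗ J.jmul)

@[simp]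
theorem jmulL_apply (a b : E) : J.jmulL a b = J.jmul a b := rfl

end EJA

/-- second order necessary condition via slack variables, under
nondegeneracy at a local minimum of (P1). -/
theorem stmt15 {E : Type*} [NormedAddCommGroup E] [InnerProductSpace ℝ E]
    [FiniteDimensional ℝ E] (J : EJA E) {n m : ℕ}
    (f : EuclideanSpace ℝ (Fin n) → ℝ)
    (h : EuclideanSpace ℝ (Fin n) → EuclideanSpace ℝ (Fin m))
    (g : EuclideanSpace ℝ (Fin n) → E)
    (hf : ContDiff ℝ 2 f) (hh : ContDiff ℝ 2 h) (hg : ContDiff ℝ 2 g)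
    (x : EuclideanSpace ℝ (Fin n)) (μ : EuclideanSpace ℝ (Fin m)) (lam : E)
    (hmin : IsLocalMinOn f {x' : EuclideanSpace ℝ (Fin n) | h x' = 0 ∧ g x' ∈ J.K} x)
    (hKKT : J.KKTP1 f h g x μ lam)
    (hnondeg : ∀ (v : EuclideanSpace ℝ (Fin m)) (w : E),
      (∀ u ∈ J.linTangent (g x), ⟪w, u⟫ = 0) →
      (fderiv ℝ g x).adjoint w + (fderiv ℝ h x).adjoint v = 0 →
      w = 0 ∧ v = 0)
    (s : E) (hsK : s ∈ J.K) (hs : J.jmul s s = g x) :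
    ∀ (v : EuclideanSpace ℝ (Fin n)) (w : E),
      fderiv ℝ g x v - (2 : ℝ) • J.jmul s w = 0 → fderiv ℝ h x v = 0 →
      0 ≤ iteratedFDeriv ℝ 2 (EJA.lagr f h g μ lam) x ![v, v]
          + 2 * ⟪J.jmul w w, lam⟫ := by
  intro v w hvw hv
  obtain ⟨hgrad, hlamK, -, hcomp, hhx⟩ := hKKT
  have hlams : J.jmul lam s = 0 := by
    refine J.jmul_eq_zero_of_inner_eq_zero_s15 hlamK ?_
    rw [J.inner_jmul_jmul, hs, real_inner_comm, ← J.unit_jmul lam, J.assoc_inner, hcomp,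
      inner_zero_right]
  have hfd : ∀ y, HasFDerivAt f (fderiv ℝ f y) y := fun y =>
    (hf.differentiable (by norm_num) y).hasFDerivAt
  have hhd : ∀ y, HasFDerivAt h (fderiv ℝ h y) y := fun y =>
    (hh.differentiable (by norm_num) y).hasFDerivAt
  have hgd : ∀ y, HasFDerivAt g (fderiv ℝ g y) y := fun y =>
    (hg.differentiable (by norm_num) y).hasFDerivAt
  have hL : ContDiff ℝ 2 (EJA.lagr f h g μ lam) :=
    (hf.sub (hh.inner ℝ contDiff_const)).sub (hg.inner ℝ contDiff_const)
  have hL0 : fderiv ℝ (EJA.lagr f h g μ lam) x = 0 := by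
    have hder := ((hfd x).sub ((hhd x).inner ℝ (hasFDerivAt_const μ x))).sub
      ((hgd x).inner ℝ (hasFDerivAt_const lam x))
    refine (HasFDerivAt.fderiv (f := EJA.lagr f h g μ lam) hder).trans ?_
    ext u
    have hu := congrArg (fun z => ⟪z, u⟫) hgrad
    simp only [inner_sub_left, ContinuousLinearMap.adjoint_inner_left, inner_zero_left,
      inner_gradient_left] at hu
    simpa [fderivInnerCLM_apply, real_inner_comm] using hu
  -- the slack-variable constraint map and its derivative
  let G : EuclideanSpace ℝ (Fin n) × E → EuclideanSpace ℝ (Fin m) × E :=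
    fun p => (h p.1, g p.1 - J.jmulL p.2 p.2)
  let G' : EuclideanSpace ℝ (Fin n) × E →L[ℝ] EuclideanSpace ℝ (Fin m) × E :=
    ((fderiv ℝ h x).comp (ContinuousLinearMap.fst ℝ _ _)).prod
      ((fderiv ℝ g x).comp (ContinuousLinearMap.fst ℝ _ _)
        - (2 : ℝ) • (J.jmulL s).comp (ContinuousLinearMap.snd ℝ _ _))
  have hG : HasStrictFDerivAt G G' (x, s) := by
    have hsm : ContDiff ℝ 1 G := by
      have h1 : ContDiff ℝ 1 h := hh.of_le (by norm_num)
      have h2 : ContDiff ℝ 1 g := hg.of_le (by norm_num)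
      exact (h1.comp contDiff_fst).prodMk ((h2.comp contDiff_fst).sub
        ((J.jmulL.contDiff.comp contDiff_snd).clm_apply contDiff_snd))
    refine hsm.contDiffAt.hasStrictFDerivAt' ?_ (by norm_num)
    have hfst := hasFDerivAt_fst (𝕜 := ℝ) (p := (x, s))
    have hsnd := hasFDerivAt_snd (𝕜 := ℝ) (p := (x, s))
    refine HasFDerivAt.congr_fderiv (((hhd x).comp (x, s) hfst).prodMk
      (((hgd x).comp (x, s) hfst).sub
        ((J.jmulL.hasFDerivAt.comp (x, s) hsnd).clm_apply hsnd))) ?_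
    refine ContinuousLinearMap.ext fun q => Prod.ext ?_ ?_
    · simp [G']
    · simp [G', J.comm q.2 s, two_smul]
  have hsurj : G'.range = ⊤ := by
    refine LinearMap.range_eq_top_of_forall_inner_add_eq_zero _ fun a b hab => ?_
    have hsb : J.jmul s b = 0 := by
      have := hab (0, J.jmul s b)
      simp only [G', ContinuousLinearMap.coe_coe, ContinuousLinearMap.prod_apply,
        ContinuousLinearMap.comp_apply, ContinuousLinearMap.coe_fst', map_zero, inner_zero_right,
        sub_apply, smul_apply,
        ContinuousLinearMap.coe_snd', EJA.jmulL_apply, zero_sub, inner_neg_right,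
        inner_smul_right, zero_add] at this
      rw [← J.assoc_inner, J.comm b s] at this
      exact inner_self_eq_zero (𝕜 := ℝ).1 (by linarith)
    have hadj : (fderiv ℝ g x).adjoint b + (fderiv ℝ h x).adjoint a = 0 := by
      refine ext_inner_right ℝ fun u => ?_
      have := hab (u, 0)
      simp only [G', ContinuousLinearMap.coe_coe, ContinuousLinearMap.prod_apply,
        ContinuousLinearMap.comp_apply, ContinuousLinearMap.coe_fst', map_zero,
        sub_apply, smul_apply,
        ContinuousLinearMap.coe_snd', smul_zero, sub_zero] at this
      rw [inner_add_left, ContinuousLinearMap.adjoint_inner_left,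
        ContinuousLinearMap.adjoint_inner_left, inner_zero_left]
      linarith
    exact (hnondeg a b (fun u hu => J.inner_linTangent_eq_zero hsK hsb (hs ▸ hu)) hadj).symm
  have hker : G' (v, w) = 0 := by
    refine Prod.ext ?_ ?_
    · simpa [G'] using hv
    · simpa [G'] using hvw
  obtain ⟨γ, hγ0, hγ, hγG⟩ := hG.exists_curve_of_mem_ker hsurj hker
  have hγ1 : HasDerivAt (fun t => (γ t).1) v 0 := hγ.fst
  have hγ2 : HasDerivAt (fun t => (γ t).2) w 0 := hγ.snd
  have hlim1 := hL.tendsto_second_order_quotient hL0 hγ1 (by rw [hγ0])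
  have hslope : Tendsto (fun t : ℝ => t⁻¹ • ((γ t).2 - s)) (𝓝[≠] 0) (𝓝 w) := by
    simpa [hγ0] using hasDerivAt_iff_tendsto_slope_zero.1 hγ2
  have hlim2 : Tendsto (fun t : ℝ => ⟪J.jmulL (t⁻¹ • ((γ t).2 - s)) (t⁻¹ • ((γ t).2 - s)), lam⟫)
      (𝓝[≠] 0) (𝓝 ⟪J.jmulL w w, lam⟫) :=
    ((J.jmulL.continuous₂.tendsto (w, w)).comp (hslope.prodMk_nhds hslope)).inner tendsto_const_nhds
  have hfeas : ∀ᶠ t in 𝓝 (0 : ℝ), f x ≤ f (γ t).1 := by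
    have hcont : Tendsto (fun t => (γ t).1) (𝓝 0)
        (𝓝[{x' | h x' = 0 ∧ g x' ∈ J.K}] x) := by
      refine tendsto_nhdsWithin_iff.2 ⟨by simpa [hγ0] using hγ1.continuousAt.tendsto, ?_⟩
      filter_upwards [hγG] with t ht
      simp only [G, Prod.mk.injEq, EJA.jmulL_apply, hs, sub_self, hhx] at ht
      exact ⟨ht.1, (γ t).2, sub_eq_zero.1 ht.2⟩
    exact hcont.eventually hmin
  have hnonneg : ∀ᶠ t in 𝓝[≠] (0 : ℝ),
      0 ≤ (EJA.lagr f h g μ lam (γ t).1 - EJA.lagr f h g μ lam x) / t ^ 2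
        + ⟪J.jmulL (t⁻¹ • ((γ t).2 - s)) (t⁻¹ • ((γ t).2 - s)), lam⟫ := by
    filter_upwards [nhdsWithin_le_nhds hfeas, nhdsWithin_le_nhds hγG] with t hmint ht
    simp only [G, Prod.mk.injEq, EJA.jmulL_apply, hs, sub_self, hhx] at ht
    obtain ⟨ht1, ht2⟩ := ht
    have hgt : g (γ t).1 = J.jmul (γ t).2 (γ t).2 := sub_eq_zero.1 ht2
    have hslam : ∀ a, ⟪J.jmul s a, lam⟫ = 0 := fun a => by
      rw [J.comm, J.assoc_inner, J.comm, hlams, inner_zero_right]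
    have hexp : ⟪J.jmul ((γ t).2 - s) ((γ t).2 - s), lam⟫ = ⟪g (γ t).1, lam⟫ := by
      simp only [map_sub, LinearMap.sub_apply, inner_sub_left, hslam, J.comm (γ t).2 s, hgt]
      ring
    have hgx : ⟪g x, lam⟫ = 0 := by rw [← hs, hslam]
    have heq : (EJA.lagr f h g μ lam (γ t).1 - EJA.lagr f h g μ lam x) / t ^ 2
        + ⟪J.jmulL (t⁻¹ • ((γ t).2 - s)) (t⁻¹ • ((γ t).2 - s)), lam⟫
        = (f (γ t).1 - f x) / t ^ 2 := by
      simp only [EJA.jmulL_apply, map_smul, smul_apply, inner_smul_left, hexp, EJA.lagr,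
        ht1, hhx, hgx, inner_zero_left]
      simp only [conj_trivial]
      ring
    rw [heq]
    exact div_nonneg (by linarith) (sq_nonneg t)
  have hfinal := ge_of_tendsto (hlim1.add hlim2) hnonneg
  rw [iteratedFDeriv_two_apply]
  simp only [Matrix.cons_val_zero, Matrix.cons_val_one, EJA.jmulL_apply] at hfinal ⊢
  linarith
end
end

section
/- Let (E, ∘, ⟨·,·⟩) be a Euclidean Jordan algebra of rank r, and let ψ : E → E be the map ψ(y) = √(|y|), where |y| := √(y∘y) ∈ K; equivalently, if y = Σ_i σ_i c_i is a spectral decomposition of y then ψ(y) = Σ_i |σ_i|^{1/2} c_i. Then ψ is continuously differentiable on the set E* = {y ∈ E : rank y = r} of elements with all eigenvalues nonzero. -/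
open scoped RealInnerProductSpace

noncomputable section

namespace EJA

variable {E : Type*} [NormedAddCommGroup E] [InnerProductSpace ℝ E]
  [FiniteDimensional ℝ E]

/-- The minimal polynomial identity of multiplication by an idempotent `c`:
`2 L³ - 3 L² + L = 0`. -/
theorem peirce_identity (J : EJA E) {c : E} (hc : J.IsIdempotent c) (x : E) :
    (2 : ℝ) • J.jmul c (J.jmul c (J.jmul c x)) + J.jmul c x
      = (3 : ℝ) • J.jmul c (J.jmul c x) := by
  have hc' : J.jmul c c = c := hc
  have hplus := J.jordan (c + x) c
  have hminus := J.jordan (c - x) c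
  have hx := J.jordan x c
  have hcomm := J.comm (J.jmul c x) c
  simp only [map_add, map_sub, LinearMap.add_apply, LinearMap.sub_apply, hc',
    J.comm x c, hcomm] at hplus hminus hx
  linear_combination (norm := module) (1 / 2 : ℝ) • (hplus - hminus) - hx

theorem inner_jmul_left_s17 (J : EJA E) (a x w : E) :
    ⟪J.jmul a x, w⟫ = ⟪x, J.jmul a w⟫ := by
  rw [J.comm, J.assoc_inner]

theorem inner_jmul_self_nonneg_s17 (J : EJA E) {c : E} (hc : J.IsIdempotent c) (x : E) :
    0 ≤ ⟪J.jmul c x, x⟫ := by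
  have h := J.peirce_identity hc x
  have h₁ := congrArg (fun v => ⟪v, x⟫) h
  have h₂ := congrArg (fun v => ⟪v, J.jmul c x⟫) h
  have hsq := real_inner_self_nonneg (x := J.jmul c (J.jmul c x) - J.jmul c x)
  have hsq' := real_inner_self_nonneg (x := J.jmul c x)
  simp only [inner_add_left, inner_sub_left, inner_sub_right, real_inner_smul_left,
    J.inner_jmul_left_s17] at h₁ h₂ hsq hsq' ⊢
  linarith

/-- `u` acts by multiplication as a positive definite operator. -/
def IsPosDef (J : EJA E) (u : E) : Prop :=
  ∃ ε : ℝ, 0 < ε ∧ ∀ x : E, ε * ‖x‖ ^ 2 ≤ ⟪J.jmul u x, x⟫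

theorem IsPosDef.add {J : EJA E} {u v : E} (hu : J.IsPosDef u) (hv : J.IsPosDef v) :
    J.IsPosDef (u + v) := by
  obtain ⟨ε, hε, hu⟩ := hu
  obtain ⟨δ, hδ, hv⟩ := hv
  refine ⟨ε + δ, add_pos hε hδ, fun x => ?_⟩
  rw [map_add, LinearMap.add_apply, inner_add_left, add_mul]
  exact add_le_add (hu x) (hv x)

theorem IsPosDef.eq_zero_of_jmul_eq_zero {J : EJA E} {u x : E} (hu : J.IsPosDef u)
    (hx : J.jmul u x = 0) : x = 0 := by
  obtain ⟨ε, hε, hu⟩ := hu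
  have h := hu x
  rw [hx, inner_zero_left] at h
  by_contra hne
  have := mul_pos hε (pow_pos (norm_pos_iff.mpr hne) 2)
  linarith

theorem IsPosDef.eq_of_sq_eq {J : EJA E} {u v : E} (hu : J.IsPosDef u) (hv : J.IsPosDef v)
    (h : J.jmul u u = J.jmul v v) : u = v := by
  refine sub_eq_zero.mp ((hu.add hv).eq_zero_of_jmul_eq_zero ?_)
  simp only [map_add, map_sub, LinearMap.add_apply, J.comm v u, h]
  abel

theorem isOpen_isPosDef (J : EJA E) : IsOpen {u : E | J.IsPosDef u} := by
  rw [isOpen_iff_mem_nhds]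
  rintro u ⟨ε, hε, hu⟩
  have hcont : Continuous fun v => ‖J.jmul.toContinuousBilinearMap (v - u)‖ := by fun_prop
  have hev : ∀ᶠ v in nhds u, ‖J.jmul.toContinuousBilinearMap (v - u)‖ < ε / 2 :=
    hcont.continuousAt.eventually_lt_const (by simpa using hε)
  filter_upwards [hev] with v hv
  refine ⟨ε / 2, half_pos hε, fun x => ?_⟩
  have hsplit : J.jmul v x = J.jmul u x + J.jmul (v - u) x := by
    rw [← LinearMap.add_apply, ← map_add, add_sub_cancel]
  have hop : ‖J.jmul (v - u) x‖ ≤ ε / 2 * ‖x‖ :=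
    (J.jmul.toContinuousBilinearMap (v - u)).le_of_opNorm_le hv.le x
  have hinner := neg_le_of_abs_le (abs_real_inner_le_norm (J.jmul (v - u) x) x)
  have := mul_le_mul_of_nonneg_right hop (norm_nonneg x)
  rw [hsplit, inner_add_left]
  linarith [hu x]

theorem IsJordanFrame.isPosDef_sum {J : EJA E} {c : Fin J.rank → E} (hc : J.IsJordanFrame c)
    {σ : Fin J.rank → ℝ} (hσ : ∀ i, 0 < σ i) : J.IsPosDef (∑ i, σ i • c i) := by
  obtain ⟨ε, hε, hle⟩ : ∃ ε : ℝ, 0 < ε ∧ ∀ i, ε ≤ σ i := by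
    rcases isEmpty_or_nonempty (Fin J.rank) with _ | _
    · exact ⟨1, one_pos, isEmptyElim⟩
    · obtain ⟨i, hi⟩ := Finite.exists_min σ
      exact ⟨σ i, hσ i, hi⟩
  refine ⟨ε, hε, fun x => ?_⟩
  have hx : ‖x‖ ^ 2 = ∑ i, ⟪J.jmul (c i) x, x⟫ := by
    rw [← sum_inner, ← LinearMap.sum_apply, ← map_sum, hc.2.2, J.unit_jmul,
      real_inner_self_eq_norm_sq]
  rw [hx, map_sum, LinearMap.sum_apply, sum_inner, Finset.mul_sum]
  refine Finset.sum_le_sum fun i _ => ?_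
  rw [map_smul, LinearMap.smul_apply, real_inner_smul_left]
  exact mul_le_mul_of_nonneg_right (hle i) (J.inner_jmul_self_nonneg_s17 (hc.1 i).1 x)

theorem IsJordanFrame.sum_jmul_sum {J : EJA E} {c : Fin J.rank → E} (hc : J.IsJordanFrame c)
    (σ τ : Fin J.rank → ℝ) :
    J.jmul (∑ i, σ i • c i) (∑ i, τ i • c i) = ∑ i, (σ i * τ i) • c i := by
  simp only [map_sum, LinearMap.sum_apply, map_smul, LinearMap.smul_apply]
  refine Finset.sum_congr rfl fun i _ => ?_
  rw [Finset.sum_eq_single i]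
  · rw [(hc.1 i).1, smul_smul, mul_comm]
  · intro j _ hj
    simp [hc.2.1 _ _ hj]
  · simp

theorem contDiff_sq (J : EJA E) {n : WithTop ℕ∞} : ContDiff ℝ n fun u : E => J.jmul u u :=
  J.jmul.toContinuousBilinearMap.contDiff.clm_apply contDiff_id

theorem hasFDerivAt_sq (J : EJA E) (u : E) :
    HasFDerivAt (fun v : E => J.jmul v v) ((2 : ℝ) • J.jmul.toContinuousBilinearMap u) u := by
  refine (J.jmul.toContinuousBilinearMap.hasFDerivAt.clm_apply (hasFDerivAt_id u)).congr_fderiv ?_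
  ext x
  simp [J.comm x u, two_smul]

/-- A positive definite valued map is as smooth as its square. -/
theorem contDiffOn_of_sq (J : EJA E) {n : WithTop ℕ∞} (hn : n ≠ 0) {φ : E → E} {s : Set E}
    (hφ : ∀ y ∈ s, J.IsPosDef (φ y))
    (hsq : ContDiffOn ℝ n (fun y => J.jmul (φ y) (φ y)) s) : ContDiffOn ℝ n φ s := by
  intro y hy
  have hinj : Function.Injective ((2 : ℝ) • J.jmul (φ y)) := by
    rw [← LinearMap.ker_eq_bot, LinearMap.ker_eq_bot']
    intro x hx
    refine (hφ y hy).eq_zero_of_jmul_eq_zero ?_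
    simpa using hx
  let D : E ≃L[ℝ] E := (LinearEquiv.ofInjectiveEndo _ hinj).toContinuousLinearEquiv
  have hD : HasFDerivAt (fun v : E => J.jmul v v) (D : E →L[ℝ] E) (φ y) :=
    (J.hasFDerivAt_sq (φ y)).congr_fderiv (by ext x; rfl)
  have hS : ContDiffAt ℝ n (fun v : E => J.jmul v v) (φ y) := J.contDiff_sq.contDiffAt
  have hstrict := hS.hasStrictFDerivAt' hD hn
  have hpos : ∀ᶠ z in nhds (J.jmul (φ y) (φ y)), J.IsPosDef (hS.localInverse hD hn z) :=
    hstrict.localInverse_tendsto.eventually (J.isOpen_isPosDef.mem_nhds (hφ y hy))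
  have hev := hpos.and hstrict.eventually_right_inverse
  have heq : φ =ᶠ[nhdsWithin y s]
      fun w => hS.localInverse hD hn (J.jmul (φ w) (φ w)) := by
    filter_upwards [(hsq y hy).continuousWithinAt.eventually hev, self_mem_nhdsWithin]
      with w hw hws
    exact (hφ w hws).eq_of_sq_eq hw.1 hw.2.symm
  refine ContDiffWithinAt.congr_of_eventuallyEq ?_ heq (heq.self_of_nhdsWithin hy)
  exact (hS.to_localInverse hD hn).comp_contDiffWithinAt y (hsq y hy)

end EJA

/-- the spectral map `ψ(y) = √(|y|)` is continuously
differentiable on the set of elements of full rank. -/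
theorem stmt17 {E : Type*} [NormedAddCommGroup E] [InnerProductSpace ℝ E]
    [FiniteDimensional ℝ E] (J : EJA E) (ψ : E → E)
    (hψ : ∀ (y : E) (c : Fin J.rank → E) (σ : Fin J.rank → ℝ),
      J.IsJordanFrame c → y = ∑ i, σ i • c i →
      ψ y = ∑ i, Real.sqrt |σ i| • c i) :
    ContDiffOn ℝ 1 ψ {y : E | J.HasRank y J.rank} := by
  have hspec : ∀ y ∈ {y : E | J.HasRank y J.rank}, J.IsPosDef (ψ y) ∧
      J.IsPosDef (J.jmul (ψ y) (ψ y)) ∧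
      J.jmul (J.jmul (ψ y) (ψ y)) (J.jmul (ψ y) (ψ y)) = J.jmul y y := by
    rintro y ⟨c, σ, hc, rfl, hcard⟩
    have hσ : ∀ i, σ i ≠ 0 := by
      have := (Finset.card_eq_iff_eq_univ _).mp (hcard.trans (Fintype.card_fin _).symm)
      simpa [Finset.filter_eq_self, Finset.eq_univ_iff_forall] using this
    rw [hψ _ c σ hc rfl]
    simp only [hc.sum_jmul_sum, Real.mul_self_sqrt (abs_nonneg _), abs_mul_abs_self]
    exact ⟨hc.isPosDef_sum fun i => Real.sqrt_pos.mpr (abs_pos.mpr (hσ i)),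
      hc.isPosDef_sum fun i => abs_pos.mpr (hσ i), trivial⟩
  refine J.contDiffOn_of_sq one_ne_zero (fun y hy => (hspec y hy).1) ?_
  refine J.contDiffOn_of_sq one_ne_zero (fun y hy => (hspec y hy).2.1) ?_
  exact J.contDiff_sq.contDiffOn.congr fun y hy => (hspec y hy).2.2
end
end
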